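/- arXiv:2403.16215 — 2 statements merged into one kernel-verified Lean document; each statement's English description precedes it below -/
import Mathlib

section
/- Let M ∈ 𝒢_c ⊂ ℝ^{2n×2n} and let B ∈ ℝ^{n×n} be the upper-right n×n block of T_n M T_nᵀ (i.e., B_{ij} = M_{2i−1, 2j} for i, j ∈ {1,…,n}). Then B is upper triangular with diagonal entries B_{ii} = M_{2i−1, 2i} ≠ 0; consequently B is invertible and B⁻¹ is upper triangular. -/
open Matrix

/-- The perfect-shuffle permutation matrix `T_n ∈ ℝ^{2n×2n}`,
`T_n = [I_n ⊗ [1 0]; I_n ⊗ [0 1]]`.  In 0-based indexing: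
`(T_n)_{i,j} = 1` iff (`i < n` and `j = 2i`) or (`n ≤ i < 2n` and `j = 2(i−n)+1`). -/
def perfectShuffle (n : ℕ) : Matrix (Fin (2 * n)) (Fin (2 * n)) ℝ :=
  fun i j =>
    if (i.val < n ∧ j.val = 2 * i.val) ∨ (n ≤ i.val ∧ j.val = 2 * (i.val - n) + 1) then 1 else 0

/-- A square matrix is upper triangular if all entries strictly below the diagonal vanish. -/
def IsUpperTri {n : ℕ} (A : Matrix (Fin n) (Fin n) ℝ) : Prop :=
  ∀ i j : Fin n, j < i → A i j = 0

/-- The class `𝒢_c ⊂ ℝ^{2n×2n}`: block upper triangular with respect to the partition into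
`2×2` blocks, with every `2×2` diagonal block having a nonzero super-diagonal entry. -/
def MemGc {n : ℕ} (M : Matrix (Fin (2 * n)) (Fin (2 * n)) ℝ) : Prop :=
  (∀ i j : Fin n, j < i → ∀ r s : Fin 2,
    M ⟨2 * i.val + r.val, by omega⟩ ⟨2 * j.val + s.val, by omega⟩ = 0) ∧
  (∀ i : Fin n, M ⟨2 * i.val, by omega⟩ ⟨2 * i.val + 1, by omega⟩ ≠ 0)

/-- For `M ∈ 𝒢_c`, the upper-right `n×n` block `B` of `T_n M T_nᵀ` (given in 1-based indexing
by `B_{ij} = M_{2i−1,2j}`) is upper triangular with nonzero diagonal entries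
`B_{ii} = M_{2i−1,2i} ≠ 0`; consequently `B` is invertible and `B⁻¹` is upper triangular. -/
theorem upperRightBlock_of_memGc (n : ℕ) (M : Matrix (Fin (2 * n)) (Fin (2 * n)) ℝ)
    (hM : MemGc M)
    (B : Matrix (Fin n) (Fin n) ℝ)
    (hB : ∀ i j : Fin n, B i j =
      (perfectShuffle n * M * (perfectShuffle n)ᵀ) ⟨i.val, by omega⟩ ⟨n + j.val, by omega⟩) :
    IsUpperTri B ∧
    (∀ i : Fin n, B i i = M ⟨2 * i.val, by omega⟩ ⟨2 * i.val + 1, by omega⟩ ∧ B i i ≠ 0) ∧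
    IsUnit B ∧ IsUpperTri B⁻¹ := by
  have hrow : ∀ i : Fin n, ∀ k : Fin (2 * n),
      perfectShuffle n ⟨i.val, by omega⟩ k = if k = ⟨2 * i.val, by omega⟩ then 1 else 0 := by
    intro i k
    unfold perfectShuffle
    apply if_congr _ rfl rfl
    simp only [Fin.ext_iff]
    omega
  have hcol : ∀ j : Fin n, ∀ k : Fin (2 * n),
      perfectShuffle n ⟨n + j.val, by omega⟩ k =
        if k = ⟨2 * j.val + 1, by omega⟩ then 1 else 0 := by
    intro i k
    unfold perfectShuffle
    apply if_congr _ rfl rfl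
    simp only [Fin.ext_iff]
    omega
  have hE : ∀ i j : Fin n, B i j = M ⟨2 * i.val, by omega⟩ ⟨2 * j.val + 1, by omega⟩ := by
    intro i j
    rw [hB]
    simp only [Matrix.mul_apply, Matrix.transpose_apply, hrow, hcol]
    simp
  have hU : IsUpperTri B := by
    intro i j hij
    rw [hE]
    exact hM.1 i j hij 0 1
  have hD : ∀ i, B i i ≠ 0 := fun i => by
    rw [hE]
    exact hM.2 i
  have hBT : B.BlockTriangular id := fun i j hij => hU i j hij
  have hunit : IsUnit B := by
    rw [Matrix.isUnit_iff_isUnit_det, Matrix.det_of_upperTriangular hBT, isUnit_iff_ne_zero]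
    exact Finset.prod_ne_zero_iff.mpr fun i _ => hD i
  refine ⟨hU, fun i => ⟨hE i i, hD i⟩, hunit, ?_⟩
  haveI := hunit.invertible
  intro i j hij
  exact Matrix.blockTriangular_inv_of_blockTriangular hBT hij
end

section
/- Let k_r, k_c ∈ ℕ, let 𝒜_r ∈ ℝ^{k_r×k_r} be upper triangular, let 𝒜_{rc} ∈ ℝ^{k_r×2k_c}, let 𝒜_c ∈ 𝒢_c ⊂ ℝ^{2k_c×2k_c}, and set 𝒜 = [[𝒜_r, 𝒜_{rc}],[0, 𝒜_c]] and P = blockdiag(I_{k_r}, T_{k_c}). Then P 𝒜 Pᵀ has the block form [[𝒜_{11}, 𝒜_{12}, 𝒜_{13}],[0, 𝒜_{22}, 𝒜_{23}],[0, 𝒜_{32}, 𝒜_{33}]] (blocks of sizes k_r, k_c, k_c), where 𝒜_{11} = 𝒜_r is upper triangular, the blocks 𝒜_{22}, 𝒜_{23}, 𝒜_{32}, 𝒜_{33} ∈ ℝ^{k_c×k_c} are all upper triangular, and 𝒜_{23} is invertible. -/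
open Matrix

/-- The block matrix `𝒜 = [[𝒜_r, 𝒜_rc], [0, 𝒜_c]] ∈ ℝ^{(k_r+2k_c)×(k_r+2k_c)}`. -/
def blockUpper (k_r k_c : ℕ) (Ar : Matrix (Fin k_r) (Fin k_r) ℝ)
    (Arc : Matrix (Fin k_r) (Fin (2 * k_c)) ℝ)
    (Ac : Matrix (Fin (2 * k_c)) (Fin (2 * k_c)) ℝ) :
    Matrix (Fin (k_r + 2 * k_c)) (Fin (k_r + 2 * k_c)) ℝ :=
  fun i j =>
    if hi : i.val < k_r then
      if hj : j.val < k_r then Ar ⟨i.val, hi⟩ ⟨j.val, hj⟩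
      else Arc ⟨i.val, hi⟩ ⟨j.val - k_r, by omega⟩
    else
      if hj : j.val < k_r then 0
      else Ac ⟨i.val - k_r, by omega⟩ ⟨j.val - k_r, by omega⟩

/-- The permutation matrix `P = blockdiag(I_{k_r}, T_{k_c}) ∈ ℝ^{(k_r+2k_c)×(k_r+2k_c)}`. -/
def Pmat (k_r k_c : ℕ) : Matrix (Fin (k_r + 2 * k_c)) (Fin (k_r + 2 * k_c)) ℝ :=
  fun i j =>
    if i.val < k_r then (if j = i then 1 else 0)
    else
      if hj : j.val < k_r then 0
      else if hi : i.val < k_r then 0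
      else perfectShuffle k_c ⟨i.val - k_r, by omega⟩ ⟨j.val - k_r, by omega⟩

def shufIdx (k_r k_c : ℕ) (i : Fin (k_r + 2 * k_c)) : Fin (k_r + 2 * k_c) :=
  ⟨if i.val < k_r then i.val else if i.val < k_r + k_c then k_r + 2 * (i.val - k_r)
    else k_r + 2 * (i.val - k_r - k_c) + 1, by split_ifs <;> omega⟩

lemma Pmat_eq (k_r k_c : ℕ) (i j : Fin (k_r + 2 * k_c)) :
    Pmat k_r k_c i j = if j = shufIdx k_r k_c i then 1 else 0 := by
  unfold Pmat perfectShuffle shufIdx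
  simp only [Fin.ext_iff]
  split_ifs <;> first | rfl | (exfalso; omega)

lemma conj_apply (k_r k_c : ℕ) (A : Matrix (Fin (k_r + 2 * k_c)) (Fin (k_r + 2 * k_c)) ℝ)
    (i j : Fin (k_r + 2 * k_c)) :
    (Pmat k_r k_c * A * (Pmat k_r k_c)ᵀ) i j = A (shufIdx k_r k_c i) (shufIdx k_r k_c j) := by
  simp [Matrix.mul_apply, Pmat_eq]

lemma blockUpper_cc (k_r k_c : ℕ) (Ar : Matrix (Fin k_r) (Fin k_r) ℝ)
    (Arc : Matrix (Fin k_r) (Fin (2 * k_c)) ℝ)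
    (Ac : Matrix (Fin (2 * k_c)) (Fin (2 * k_c)) ℝ) (i j : Fin (k_r + 2 * k_c))
    (a b : Fin (2 * k_c)) (hi : i.val = k_r + a.val) (hj : j.val = k_r + b.val) :
    blockUpper k_r k_c Ar Arc Ac i j = Ac a b := by
  unfold blockUpper
  rw [dif_neg (by omega), dif_neg (by omega)]
  congr 1 <;> (apply Fin.ext; simp; omega)

lemma shuf_lo (k_r k_c a : ℕ) (ha : a < k_c) :
    (shufIdx k_r k_c ⟨k_r + a, by omega⟩).val = k_r + 2 * a := by
  simp only [shufIdx]; split_ifs <;> omega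

lemma shuf_hi (k_r k_c a : ℕ) (ha : a < k_c) :
    (shufIdx k_r k_c ⟨k_r + k_c + a, by omega⟩).val = k_r + (2 * a + 1) := by
  simp only [shufIdx]; split_ifs <;> omega

/-- Conjugating `𝒜 = [[𝒜_r, 𝒜_rc], [0, 𝒜_c]]` (with `𝒜_r` upper triangular and `𝒜_c ∈ 𝒢_c`)
by `P = blockdiag(I_{k_r}, T_{k_c})` yields a matrix with block structure
`[[𝒜₁₁, 𝒜₁₂, 𝒜₁₃], [0, 𝒜₂₂, 𝒜₂₃], [0, 𝒜₃₂, 𝒜₃₃]]` (blocks of sizes `k_r, k_c, k_c`),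
where `𝒜₁₁ = 𝒜_r` is upper triangular, `𝒜₂₂, 𝒜₂₃, 𝒜₃₂, 𝒜₃₃` are upper triangular,
and `𝒜₂₃` is invertible. -/
theorem conj_blockUpper_structure (k_r k_c : ℕ)
    (Ar : Matrix (Fin k_r) (Fin k_r) ℝ) (hAr : IsUpperTri Ar)
    (Arc : Matrix (Fin k_r) (Fin (2 * k_c)) ℝ)
    (Ac : Matrix (Fin (2 * k_c)) (Fin (2 * k_c)) ℝ) (hAc : MemGc Ac)
    (N : Matrix (Fin (k_r + 2 * k_c)) (Fin (k_r + 2 * k_c)) ℝ)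
    (hN : N = Pmat k_r k_c * blockUpper k_r k_c Ar Arc Ac * (Pmat k_r k_c)ᵀ)
    (A11 : Matrix (Fin k_r) (Fin k_r) ℝ)
    (hA11 : ∀ i j : Fin k_r, A11 i j = N ⟨i.val, by omega⟩ ⟨j.val, by omega⟩)
    (A22 A23 A32 A33 : Matrix (Fin k_c) (Fin k_c) ℝ)
    (hA22 : ∀ i j : Fin k_c, A22 i j = N ⟨k_r + i.val, by omega⟩ ⟨k_r + j.val, by omega⟩)
    (hA23 : ∀ i j : Fin k_c, A23 i j = N ⟨k_r + i.val, by omega⟩ ⟨k_r + k_c + j.val, by omega⟩)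
    (hA32 : ∀ i j : Fin k_c, A32 i j = N ⟨k_r + k_c + i.val, by omega⟩ ⟨k_r + j.val, by omega⟩)
    (hA33 : ∀ i j : Fin k_c,
      A33 i j = N ⟨k_r + k_c + i.val, by omega⟩ ⟨k_r + k_c + j.val, by omega⟩) :
    (∀ i j : Fin (k_r + 2 * k_c), k_r ≤ i.val → j.val < k_r → N i j = 0) ∧
    (∀ i j : Fin k_r, A11 i j = Ar i j) ∧ IsUpperTri A11 ∧
    IsUpperTri A22 ∧ IsUpperTri A23 ∧ IsUpperTri A32 ∧ IsUpperTri A33 ∧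
    IsUnit A23 := by
  obtain ⟨h0, h1⟩ := hAc
  have e22 : ∀ i j : Fin k_c, A22 i j = Ac ⟨2 * i.val, by omega⟩ ⟨2 * j.val, by omega⟩ := by
    intro i j
    rw [hA22, hN, conj_apply]
    exact blockUpper_cc _ _ _ _ _ _ _ _ _ (shuf_lo _ _ _ i.2) (shuf_lo _ _ _ j.2)
  have e23 : ∀ i j : Fin k_c, A23 i j = Ac ⟨2 * i.val, by omega⟩ ⟨2 * j.val + 1, by omega⟩ := by
    intro i j
    rw [hA23, hN, conj_apply]
    exact blockUpper_cc _ _ _ _ _ _ _ _ _ (shuf_lo _ _ _ i.2) (shuf_hi _ _ _ j.2)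
  have e32 : ∀ i j : Fin k_c, A32 i j = Ac ⟨2 * i.val + 1, by omega⟩ ⟨2 * j.val, by omega⟩ := by
    intro i j
    rw [hA32, hN, conj_apply]
    exact blockUpper_cc _ _ _ _ _ _ _ _ _ (shuf_hi _ _ _ i.2) (shuf_lo _ _ _ j.2)
  have e33 : ∀ i j : Fin k_c,
      A33 i j = Ac ⟨2 * i.val + 1, by omega⟩ ⟨2 * j.val + 1, by omega⟩ := by
    intro i j
    rw [hA33, hN, conj_apply]
    exact blockUpper_cc _ _ _ _ _ _ _ _ _ (shuf_hi _ _ _ i.2) (shuf_hi _ _ _ j.2)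
  have e11 : ∀ i j : Fin k_r, A11 i j = Ar i j := by
    intro i j
    rw [hA11, hN, conj_apply]
    simp [blockUpper, shufIdx]
  have u23 : IsUpperTri A23 := fun i j h => (e23 i j).trans (h0 i j h 0 1)
  refine ⟨?_, e11, fun i j h => (e11 i j).trans (hAr i j h),
    fun i j h => (e22 i j).trans (h0 i j h 0 0), u23,
    fun i j h => (e32 i j).trans (h0 i j h 1 0),
    fun i j h => (e33 i j).trans (h0 i j h 1 1), ?_⟩
  · intro i j hi hj
    rw [hN, conj_apply]
    have a1 : ¬ (shufIdx k_r k_c i).val < k_r := by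
      simp only [shufIdx]; split_ifs <;> omega
    have a2 : (shufIdx k_r k_c j).val < k_r := by
      simp only [shufIdx]; split_ifs; omega
    unfold blockUpper
    rw [dif_neg a1, dif_pos a2]
  · rw [Matrix.isUnit_iff_isUnit_det, Matrix.det_of_upperTriangular (fun i j h => u23 i j h),
      isUnit_iff_ne_zero]
    refine Finset.prod_ne_zero_iff.mpr fun i _ => ?_
    rw [e23]
    exact h1 i
end
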